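/- arXiv:2502.06742 — 8 statements merged into one kernel-verified Lean document; each statement's English description precedes it below -/
import Mathlib

section
/- Let g be a norm on a finite-dimensional real inner product space E and let P be a normalized-projection selection for g satisfying Assumption A(c) for some constant c > 0. Then P is idempotent: P(P(x)) = P(x) for every x ∈ E. -/
open scoped RealInnerProductSpace

/-- `g` is a norm on `E`: nonnegative, positive definite, absolutely homogeneous,
and satisfying the triangle inequality. -/
def IsNorm {E : Type*} [NormedAddCommGroup E] [InnerProductSpace ℝ E] (g : E → ℝ) : Prop :=
  (∀ x, 0 ≤ g x) ∧ (∀ x, g x = 0 ↔ x = 0) ∧ (∀ (r : ℝ) (x : E), g (r • x) = |r| * g x) ∧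
    (∀ x y, g (x + y) ≤ g x + g y)

/-- `P` is a normalized-projection selection for the norm `g`:
for every `x`, `g (P x) = 1` and `⟪x, z⟫ ≤ ⟪x, P x⟫` for every `z` with `g z = 1`. -/
def IsNormalizedProjection {E : Type*} [NormedAddCommGroup E] [InnerProductSpace ℝ E]
    (g : E → ℝ) (P : E → E) : Prop :=
  (∀ x, g (P x) = 1) ∧ ∀ x z, g z = 1 → ⟪x, z⟫ ≤ ⟪x, P x⟫

theorem idempotent_of_constant_norm_projection
    {E : Type*} [NormedAddCommGroup E] [InnerProductSpace ℝ E] [FiniteDimensional ℝ E]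
    (g : E → ℝ) (hg : IsNorm g) (P : E → E) (hP : IsNormalizedProjection g P)
    (c : ℝ) (hc : 0 < c) (hA : ∀ x, ‖P x‖ = c) :
    ∀ x, P (P x) = P x := by
  intro x
  have h := hP.2 (P x) (P x) (hP.1 x)
  have hsq := norm_sub_sq_real (P (P x)) (P x)
  rw [real_inner_self_eq_norm_sq, real_inner_comm, hA] at h
  rw [hA, hA] at hsq
  have hzero : ‖P (P x) - P x‖ ^ 2 ≤ 0 := by linarith
  exact sub_eq_zero.mp (norm_eq_zero.mp (pow_eq_zero_iff two_ne_zero |>.mp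
    (le_antisymm hzero (sq_nonneg _))))
end

section
/- Let g be a norm on a finite-dimensional real inner product space E and let P be a normalized-projection selection for g satisfying Assumption A(c) for some constant c > 0. Then for every x ∈ E, g*(P(x)) = ‖P(x)‖₂² = c², where g* is the dual norm of g. -/
open scoped RealInnerProductSpace

/-- The dual norm of `g`: `g*(y) = sup {⟪y, z⟫ : g z ≤ 1}`. -/
noncomputable def dualNorm {E : Type*} [NormedAddCommGroup E] [InnerProductSpace ℝ E]
    (g : E → ℝ) (y : E) : ℝ :=
  sSup {r : ℝ | ∃ z : E, g z ≤ 1 ∧ r = ⟪y, z⟫}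

/-- A bound for `⟪y, ·⟫` on the unit sphere of a norm `g` extends to the unit ball. -/
theorem IsNorm.inner_le_of_forall_sphere {E : Type*} [NormedAddCommGroup E]
    [InnerProductSpace ℝ E] {g : E → ℝ} (hg : IsNorm g) {y : E} {b : ℝ} (hb : 0 ≤ b)
    (h : ∀ z, g z = 1 → ⟪y, z⟫ ≤ b) {z : E} (hz : g z ≤ 1) : ⟪y, z⟫ ≤ b := by
  obtain ⟨hnonneg, hzero, hsmul, -⟩ := hg
  rcases eq_or_ne z 0 with rfl | hz0
  · simpa using hb
  have hpos : 0 < g z := (hnonneg z).lt_of_ne' fun h0 => hz0 ((hzero z).1 h0)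
  have hscaled := h ((g z)⁻¹ • z) (by
    rw [hsmul, abs_of_pos (inv_pos.2 hpos), inv_mul_cancel₀ hpos.ne'])
  rw [real_inner_smul_right, inv_mul_le_iff₀ hpos] at hscaled
  exact hscaled.trans (mul_le_of_le_one_left hb hz)

theorem dualNorm_of_constant_norm_projection
    {E : Type*} [NormedAddCommGroup E] [InnerProductSpace ℝ E] [FiniteDimensional ℝ E]
    (g : E → ℝ) (hg : IsNorm g) (P : E → E) (hP : IsNormalizedProjection g P)
    (c : ℝ) (hc : 0 < c) (hA : ∀ x, ‖P x‖ = c) :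
    ∀ x, dualNorm g (P x) = ‖P x‖ ^ 2 ∧ ‖P x‖ ^ 2 = c ^ 2 := by
  intro x
  refine ⟨?_, by rw [hA x]⟩
  have hsphere : ∀ z, g z = 1 → ⟪P x, z⟫ ≤ ‖P x‖ ^ 2 := fun z hz =>
    calc ⟪P x, z⟫ ≤ ⟪P x, P (P x)⟫ := hP.2 (P x) z hz
      _ ≤ ‖P x‖ * ‖P (P x)‖ := real_inner_le_norm _ _
      _ = ‖P x‖ ^ 2 := by rw [hA (P x), hA x, sq]
  refine IsGreatest.csSup_eq ⟨⟨P x, (hP.1 x).le, (real_inner_self_eq_norm_sq _).symm⟩, ?_⟩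
  rintro _ ⟨z, hz, rfl⟩
  exact hg.inner_le_of_forall_sphere (sq_nonneg _) hsphere hz
end

section
/- Let g₁, g₂ be norms on a finite-dimensional real inner product space E with normalized-projection selections P₁, P₂ both satisfying Assumption A(c) with the same constant c > 0, and let (xₙ) be the alternating sequence started from any x₀ ∈ E. Then the sequence of inner products (⟨xₙ, x_{n+1}⟩)_{n≥1} is nondecreasing and bounded above by c², i.e. for all n ≥ 1, ⟨xₙ, x_{n+1}⟩ ≤ ⟨x_{n+1}, x_{n+2}⟩ ≤ c²; in particular it converges. -/
open scoped RealInnerProductSpace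

theorem alternating_sequence_inner_monotone_bounded
    {E : Type*} [NormedAddCommGroup E] [InnerProductSpace ℝ E] [FiniteDimensional ℝ E]
    (g₁ g₂ : E → ℝ) (hg₁ : IsNorm g₁) (hg₂ : IsNorm g₂)
    (P₁ P₂ : E → E) (hP₁ : IsNormalizedProjection g₁ P₁) (hP₂ : IsNormalizedProjection g₂ P₂)
    (c : ℝ) (hc : 0 < c) (hA₁ : ∀ x, ‖P₁ x‖ = c) (hA₂ : ∀ x, ‖P₂ x‖ = c)
    (x : ℕ → E)
    (hodd : ∀ n : ℕ, x (2 * n + 1) = P₁ (x (2 * n)))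
    (heven : ∀ n : ℕ, x (2 * n + 2) = P₂ (x (2 * n + 1))) :
    (∀ n : ℕ, 1 ≤ n →
        ⟪x n, x (n + 1)⟫ ≤ ⟪x (n + 1), x (n + 2)⟫ ∧ ⟪x (n + 1), x (n + 2)⟫ ≤ c ^ 2) ∧
      ∃ r : ℝ, Filter.Tendsto (fun n => ⟪x n, x (n + 1)⟫) Filter.atTop (nhds r) := by
  have hnorm : ∀ n : ℕ, ‖x (n + 1)‖ = c := by
    intro n
    rcases n.even_or_odd' with ⟨k, rfl | rfl⟩
    · rw [hodd, hA₁]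
    · rw [heven, hA₂]
  have hmono : ∀ n : ℕ, ⟪x (n + 1), x (n + 2)⟫ ≤ ⟪x (n + 2), x (n + 3)⟫ := by
    intro n
    rw [real_inner_comm]
    rcases n.even_or_odd' with ⟨k, rfl | rfl⟩
    · rw [show x (2 * k + 3) = P₁ (x (2 * k + 2)) from hodd (k + 1)]
      exact hP₁.2 _ _ (by rw [hodd, hP₁.1])
    · rw [show x (2 * k + 1 + 3) = P₂ (x (2 * k + 1 + 2)) from heven (k + 1)]
      exact hP₂.2 _ _ (by rw [heven, hP₂.1])
  have hbound : ∀ n : ℕ, ⟪x (n + 1), x (n + 2)⟫ ≤ c ^ 2 := by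
    intro n
    simpa [hnorm, sq] using real_inner_le_norm (x (n + 1)) (x (n + 2))
  refine ⟨fun n hn => ?_, ?_⟩
  · obtain ⟨m, rfl⟩ := Nat.exists_eq_add_of_le' hn
    exact ⟨hmono m, hbound (m + 1)⟩
  · have hlim := tendsto_atTop_ciSup (monotone_nat_of_le_succ hmono)
      ⟨c ^ 2, Set.forall_mem_range.2 hbound⟩
    exact ⟨_, (Filter.tendsto_add_atTop_iff_nat (f := fun n => ⟪x n, x (n + 1)⟫) 1).1 hlim⟩
end

section
/- Let m, n ≥ 1 and let W ∈ ℝ^{m×n} have all rows nonzero. Define the norm g₁(Z) := max_{1≤i≤m} ‖Z_{i,:}‖₂ / √n on ℝ^{m×n} and set X := √n · Q(W)^{-1} W (i.e. X_{i,:} = √n · W_{i,:} / ‖W_{i,:}‖₂ for each i). Then g₁(X) = 1 and ⟨W, Z⟩_F ≤ ⟨W, X⟩_F for every Z ∈ ℝ^{m×n} with g₁(Z) = 1; that is, row-wise ℓ2-normalization realizes the normalized projection with respect to g₁. -/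
open Matrix

/-- The Euclidean norm of the `i`-th row of a matrix. -/
noncomputable def rowNorm {m n : ℕ} (W : Matrix (Fin m) (Fin n) ℝ) (i : Fin m) : ℝ :=
  Real.sqrt (∑ j, W i j ^ 2)

/-- The Frobenius inner product of two matrices. -/
def frobInner {m n : ℕ} (A B : Matrix (Fin m) (Fin n) ℝ) : ℝ :=
  ∑ i, ∑ j, A i j * B i j

/-- The norm `g₁(Z) = max_i ‖Z_{i,:}‖₂ / √n`. -/
noncomputable def gRow {m n : ℕ} [NeZero m] (Z : Matrix (Fin m) (Fin n) ℝ) : ℝ :=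
  (⨆ i : Fin m, rowNorm Z i) / Real.sqrt n

lemma rowNorm_pos {m n : ℕ} {W : Matrix (Fin m) (Fin n) ℝ} {i : Fin m}
    (h : ∃ j, W i j ≠ 0) : 0 < rowNorm W i := by
  obtain ⟨j, hj⟩ := h
  exact Real.sqrt_pos.2 (Finset.sum_pos' (fun k _ => sq_nonneg (W i k))
    ⟨j, Finset.mem_univ j, by positivity⟩)

lemma rowNorm_sq {m n : ℕ} (W : Matrix (Fin m) (Fin n) ℝ) (i : Fin m) :
    rowNorm W i ^ 2 = ∑ j, W i j ^ 2 :=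
  Real.sq_sqrt (Finset.sum_nonneg fun j _ => sq_nonneg (W i j))

lemma rowNorm_eq_mul_of_row_eq_smul {m n : ℕ} {X W : Matrix (Fin m) (Fin n) ℝ} {i : Fin m}
    {c : ℝ} (hc : 0 ≤ c) (h : ∀ j, X i j = c * W i j) : rowNorm X i = c * rowNorm W i := by
  simp only [rowNorm, h, mul_pow, ← Finset.mul_sum]
  rw [Real.sqrt_mul (sq_nonneg c), Real.sqrt_sq hc]

lemma rowNorm_le_sqrt_mul_gRow {m n : ℕ} [NeZero m] [NeZero n]
    (Z : Matrix (Fin m) (Fin n) ℝ) (i : Fin m) : rowNorm Z i ≤ √n * gRow Z := by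
  have hn : (0 : ℝ) < √n := Real.sqrt_pos.2 (Nat.cast_pos.2 (NeZero.pos n))
  rw [gRow, mul_div_cancel₀ _ hn.ne']
  exact le_ciSup (Set.finite_range (rowNorm Z)).bddAbove i

theorem row_normalization_is_normalized_projection
    {m n : ℕ} [NeZero m] [NeZero n] (W : Matrix (Fin m) (Fin n) ℝ)
    (hW : ∀ i : Fin m, ∃ j : Fin n, W i j ≠ 0)
    (X : Matrix (Fin m) (Fin n) ℝ)
    (hX : ∀ i j, X i j = Real.sqrt n * W i j / rowNorm W i) :
    gRow X = 1 ∧ ∀ Z : Matrix (Fin m) (Fin n) ℝ, gRow Z = 1 → frobInner W Z ≤ frobInner W X := by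
  have hn : (0 : ℝ) < √n := Real.sqrt_pos.2 (Nat.cast_pos.2 (NeZero.pos n))
  have hpos (i : Fin m) : 0 < rowNorm W i := rowNorm_pos (hW i)
  have hX' (i : Fin m) (j : Fin n) : X i j = √n / rowNorm W i * W i j := by
    rw [hX, div_mul_eq_mul_div]
  have hrow (i : Fin m) : rowNorm X i = √n := by
    rw [rowNorm_eq_mul_of_row_eq_smul (div_nonneg hn.le (hpos i).le) (hX' i),
      div_mul_cancel₀ _ (hpos i).ne']
  refine ⟨by simp only [gRow, hrow, ciSup_const, div_self hn.ne'], fun Z hZ => ?_⟩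
  refine Finset.sum_le_sum fun i _ => ?_
  calc ∑ j, W i j * Z i j
      ≤ rowNorm W i * rowNorm Z i := Real.sum_mul_le_sqrt_mul_sqrt _ _ _
    _ ≤ rowNorm W i * √n := by
      have := rowNorm_le_sqrt_mul_gRow Z i
      rw [hZ, mul_one] at this
      exact mul_le_mul_of_nonneg_left this (hpos i).le
    _ = √n / rowNorm W i * rowNorm W i ^ 2 := by
      have := (hpos i).ne'
      field_simp
    _ = ∑ j, W i j * X i j := by
      rw [rowNorm_sq, Finset.mul_sum]
      refine Finset.sum_congr rfl fun j _ => ?_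
      rw [hX']
      ring
end

section
/- Let m, n ≥ 1 and let W ∈ ℝ^{m×n} have all columns nonzero. Define the norm g₂(Z) := max_{1≤j≤n} ‖Z_{:,j}‖₂ / √m on ℝ^{m×n} and set X := √m · W R(W)^{-1} (i.e. X_{:,j} = √m · W_{:,j} / ‖W_{:,j}‖₂ for each j). Then g₂(X) = 1 and ⟨W, Z⟩_F ≤ ⟨W, X⟩_F for every Z ∈ ℝ^{m×n} with g₂(Z) = 1; that is, column-wise ℓ2-normalization realizes the normalized projection with respect to g₂. -/
open Matrix

/-- The Euclidean norm of the `j`-th column of a matrix. -/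
noncomputable def colNorm {m n : ℕ} (W : Matrix (Fin m) (Fin n) ℝ) (j : Fin n) : ℝ :=
  Real.sqrt (∑ i, W i j ^ 2)

/-- The norm `g₂(Z) = max_j ‖Z_{:,j}‖₂ / √m`. -/
noncomputable def gCol {m n : ℕ} [NeZero n] (Z : Matrix (Fin m) (Fin n) ℝ) : ℝ :=
  (⨆ j : Fin n, colNorm Z j) / Real.sqrt m

theorem colNorm_nonneg {m n : ℕ} (W : Matrix (Fin m) (Fin n) ℝ) (j : Fin n) : 0 ≤ colNorm W j :=
  Real.sqrt_nonneg _

theorem colNorm_sq {m n : ℕ} (W : Matrix (Fin m) (Fin n) ℝ) (j : Fin n) :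
    colNorm W j ^ 2 = ∑ i, W i j ^ 2 :=
  Real.sq_sqrt (Finset.sum_nonneg fun _ _ => sq_nonneg _)

theorem colNorm_pos {m n : ℕ} {W : Matrix (Fin m) (Fin n) ℝ} {j : Fin n}
    (h : ∃ i, W i j ≠ 0) : 0 < colNorm W j := by
  obtain ⟨i, hi⟩ := h
  exact Real.sqrt_pos.2 <| Finset.sum_pos' (fun _ _ => sq_nonneg _)
    ⟨i, Finset.mem_univ i, by positivity⟩

/-- Cauchy–Schwarz, column by column. -/
theorem frobInner_le_sum_colNorm_mul {m n : ℕ} (A B : Matrix (Fin m) (Fin n) ℝ) :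
    frobInner A B ≤ ∑ j, colNorm A j * colNorm B j := by
  rw [frobInner, Finset.sum_comm]
  exact Finset.sum_le_sum fun j _ =>
    Real.sum_mul_le_sqrt_mul_sqrt Finset.univ (fun i => A i j) (fun i => B i j)

theorem colNorm_le_sqrt_of_gCol_eq_one {m n : ℕ} [NeZero m] [NeZero n]
    {Z : Matrix (Fin m) (Fin n) ℝ} (hZ : gCol Z = 1) (j : Fin n) : colNorm Z j ≤ Real.sqrt m := by
  have hm : 0 < Real.sqrt m := Real.sqrt_pos.2 (Nat.cast_pos.2 (NeZero.pos m))
  rw [gCol, div_eq_one_iff_eq hm.ne'] at hZ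
  exact hZ ▸ le_ciSup (Set.finite_range (colNorm Z)).bddAbove j

theorem col_normalization_is_normalized_projection
    {m n : ℕ} [NeZero m] [NeZero n] (W : Matrix (Fin m) (Fin n) ℝ)
    (hW : ∀ j : Fin n, ∃ i : Fin m, W i j ≠ 0)
    (X : Matrix (Fin m) (Fin n) ℝ)
    (hX : ∀ i j, X i j = Real.sqrt m * W i j / colNorm W j) :
    gCol X = 1 ∧ ∀ Z : Matrix (Fin m) (Fin n) ℝ, gCol Z = 1 → frobInner W Z ≤ frobInner W X := by
  have hm : 0 < Real.sqrt m := Real.sqrt_pos.2 (Nat.cast_pos.2 (NeZero.pos m))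
  have hpos : ∀ j, 0 < colNorm W j := fun j => colNorm_pos (hW j)
  have hnormX : ∀ j, colNorm X j = Real.sqrt m := fun j => by
    have hsq : colNorm X j ^ 2 = Real.sqrt m ^ 2 := by
      simp only [colNorm_sq X, hX, div_pow, mul_pow]
      rw [← Finset.sum_div, ← Finset.mul_sum, ← colNorm_sq W,
        mul_div_cancel_right₀ _ (pow_pos (hpos j) 2).ne']
    exact (sq_eq_sq₀ (colNorm_nonneg X j) hm.le).1 hsq
  have hinner : frobInner W X = ∑ j, colNorm W j * Real.sqrt m := by
    rw [frobInner, Finset.sum_comm]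
    refine Finset.sum_congr rfl fun j _ => ?_
    have hterm : ∀ i, W i j * X i j = Real.sqrt m / colNorm W j * W i j ^ 2 := fun i => by
      rw [hX]; ring
    simp only [hterm]
    rw [← Finset.mul_sum, ← colNorm_sq]
    have := (hpos j).ne'
    field_simp
  refine ⟨?_, fun Z hZ => ?_⟩
  · simp only [gCol, hnormX, ciSup_const]
    exact div_self hm.ne'
  · rw [hinner]
    exact (frobInner_le_sum_colNorm_mul W Z).trans <| Finset.sum_le_sum fun j _ =>
      mul_le_mul_of_nonneg_left (colNorm_le_sqrt_of_gCol_eq_one hZ j) (colNorm_nonneg W j)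
end

section
/- Let 1 ≤ m ≤ n and let W ∈ ℝ^{m×n} be such that WWᵀ is positive definite. Set X := √n · (WWᵀ)^{-1/2} W. Then the spectral norm of X equals √n, and ⟨W, Z⟩_F ≤ ⟨W, X⟩_F for every Z ∈ ℝ^{m×n} with spectral norm at most √n; that is, whitening realizes the normalized projection with respect to the scaled spectral norm Z ↦ ‖Z‖_{σ,∞}/√n. -/
open Matrix

/-- The Euclidean norm of a vector in `ℝ^k`. -/
noncomputable def vecNorm {k : ℕ} (v : Fin k → ℝ) : ℝ :=
  Real.sqrt (∑ i, v i ^ 2)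

/-- The spectral norm (largest singular value) of a matrix: the operator norm of
`v ↦ Z v` between Euclidean spaces. -/
noncomputable def specNorm {m n : ℕ} (Z : Matrix (Fin m) (Fin n) ℝ) : ℝ :=
  sSup {r : ℝ | ∃ v : Fin n → ℝ, vecNorm v ≤ 1 ∧ r = vecNorm (Z.mulVec v)}

lemma vecNorm_nonneg {k : ℕ} (v : Fin k → ℝ) : 0 ≤ vecNorm v :=
  Real.sqrt_nonneg _

lemma vecNorm_mul_self {k : ℕ} (v : Fin k → ℝ) : vecNorm v * vecNorm v = v ⬝ᵥ v := by
  rw [vecNorm, Real.mul_self_sqrt (Finset.sum_nonneg fun i _ => sq_nonneg (v i))]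
  simp [dotProduct, sq]

lemma vecNorm_eq_sqrt_dotProduct {k : ℕ} (v : Fin k → ℝ) : vecNorm v = Real.sqrt (v ⬝ᵥ v) := by
  simp [vecNorm, dotProduct, sq]

lemma dotProduct_le_vecNorm_mul {k : ℕ} (u v : Fin k → ℝ) : u ⬝ᵥ v ≤ vecNorm u * vecNorm v :=
  Real.sum_mul_le_sqrt_mul_sqrt _ _ _

lemma vecNorm_eq_norm {k : ℕ} (v : Fin k → ℝ) : vecNorm v = ‖WithLp.toLp 2 v‖ := by
  simp [vecNorm, EuclideanSpace.norm_eq]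

lemma vecNorm_smul {k : ℕ} (c : ℝ) (v : Fin k → ℝ) : vecNorm (c • v) = |c| * vecNorm v := by
  rw [vecNorm_eq_norm, vecNorm_eq_norm, WithLp.toLp_smul, norm_smul, Real.norm_eq_abs]

lemma bddAbove_specNorm {m n : ℕ} (Z : Matrix (Fin m) (Fin n) ℝ) :
    BddAbove {r : ℝ | ∃ v : Fin n → ℝ, vecNorm v ≤ 1 ∧ r = vecNorm (Z.mulVec v)} := by
  refine ⟨‖(Matrix.toEuclideanLin Z).toContinuousLinearMap‖, ?_⟩
  rintro r ⟨v, hv, rfl⟩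
  rw [vecNorm_eq_norm] at hv ⊢
  exact (Matrix.toEuclideanLin Z).toContinuousLinearMap.unit_le_opNorm _ hv

lemma vecNorm_mulVec_le {m n : ℕ} (Z : Matrix (Fin m) (Fin n) ℝ) (v : Fin n → ℝ) :
    vecNorm (Z *ᵥ v) ≤ specNorm Z * vecNorm v := by
  rcases (vecNorm_nonneg v).eq_or_lt with h | h
  · have hv : v = 0 := by
      rw [← dotProduct_self_eq_zero (v := v), ← vecNorm_mul_self, ← h, mul_zero]
    subst hv
    simp [vecNorm]
  · have hle : vecNorm (Z *ᵥ ((vecNorm v)⁻¹ • v)) ≤ specNorm Z := by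
      refine le_csSup (bddAbove_specNorm Z) ⟨_, ?_, rfl⟩
      rw [vecNorm_smul, abs_of_pos (inv_pos.2 h), inv_mul_cancel₀ h.ne']
    rwa [mulVec_smul, vecNorm_smul, abs_of_pos (inv_pos.2 h), inv_mul_le_iff₀ h, mul_comm] at hle

lemma vecNorm_transpose_mulVec {m n : ℕ} {P : Matrix (Fin m) (Fin n) ℝ} (hP : P * Pᵀ = 1)
    (b : Fin m → ℝ) : vecNorm (Pᵀ *ᵥ b) = vecNorm b := by
  rw [vecNorm_eq_sqrt_dotProduct, vecNorm_eq_sqrt_dotProduct b, dotProduct_mulVec,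
    vecMul_transpose, mulVec_mulVec, hP, one_mulVec]

lemma vecNorm_mulVec_le_of_mul_transpose_eq_one {m n : ℕ} {P : Matrix (Fin m) (Fin n) ℝ}
    (hP : P * Pᵀ = 1) (v : Fin n → ℝ) : vecNorm (P *ᵥ v) ≤ vecNorm v := by
  have h : vecNorm (P *ᵥ v) * vecNorm (P *ᵥ v) ≤ vecNorm (P *ᵥ v) * vecNorm v := by
    calc vecNorm (P *ᵥ v) * vecNorm (P *ᵥ v) = (Pᵀ *ᵥ (P *ᵥ v)) ⬝ᵥ v := by
          rw [vecNorm_mul_self, dotProduct_mulVec, mulVec_transpose]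
      _ ≤ vecNorm (Pᵀ *ᵥ (P *ᵥ v)) * vecNorm v := dotProduct_le_vecNorm_mul _ _
      _ = vecNorm (P *ᵥ v) * vecNorm v := by rw [vecNorm_transpose_mulVec hP]
  rcases (vecNorm_nonneg (P *ᵥ v)).eq_or_lt with h0 | h0
  · rw [← h0]
    exact vecNorm_nonneg v
  · exact le_of_mul_le_mul_left h h0

lemma specNorm_smul_of_mul_transpose_eq_one {m n : ℕ} (hm : 1 ≤ m)
    {P : Matrix (Fin m) (Fin n) ℝ} (hP : P * Pᵀ = 1) {c : ℝ} (hc : 0 ≤ c) :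
    specNorm (c • P) = c := by
  refine IsGreatest.csSup_eq ⟨?_, ?_⟩
  · have he : vecNorm (Pi.single (⟨0, hm⟩ : Fin m) (1 : ℝ)) = 1 := by
      simp [vecNorm_eq_sqrt_dotProduct]
    refine ⟨Pᵀ *ᵥ Pi.single ⟨0, hm⟩ 1, ?_, ?_⟩
    · rw [vecNorm_transpose_mulVec hP, he]
    · rw [smul_mulVec, vecNorm_smul, mulVec_mulVec, hP, one_mulVec, he, abs_of_nonneg hc, mul_one]
  · rintro r ⟨v, hv, rfl⟩
    rw [smul_mulVec, vecNorm_smul, abs_of_nonneg hc]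
    exact mul_le_of_le_one_right hc ((vecNorm_mulVec_le_of_mul_transpose_eq_one hP v).trans hv)

lemma frobInner_eq_trace {m n : ℕ} (A B : Matrix (Fin m) (Fin n) ℝ) :
    frobInner A B = (B * Aᵀ).trace := by
  simp [frobInner, trace, mul_apply, mul_comm]

lemma frobInner_polar_eq_sum {m n : ℕ} (B : Matrix (Fin m) (Fin m) ℝ)
    (P Z : Matrix (Fin m) (Fin n) ℝ) :
    frobInner (Bᵀ * B * P) Z = ∑ i, B i ⬝ᵥ Z *ᵥ (Pᵀ *ᵥ B i) := by
  have h : Z * (Bᵀ * B * P)ᵀ = (Z * Pᵀ * Bᵀ) * B := by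
    simp only [transpose_mul, transpose_transpose, Matrix.mul_assoc]
  rw [frobInner_eq_trace, h, trace_mul_comm]
  refine Finset.sum_congr rfl fun i _ => ?_
  rw [mulVec_mulVec]
  rfl

open scoped MatrixOrder in
/-- Among matrices of spectral norm at most `c`, the Frobenius inner product with `S * P`, where
`S` is positive semidefinite and `P` has orthonormal rows, is maximized by `c • P`. -/
lemma frobInner_polar_le {m n : ℕ} {S : Matrix (Fin m) (Fin m) ℝ} (hS : S.PosSemidef)
    {P : Matrix (Fin m) (Fin n) ℝ} (hP : P * Pᵀ = 1) {c : ℝ}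
    {Z : Matrix (Fin m) (Fin n) ℝ} (hZ : specNorm Z ≤ c) :
    frobInner (S * P) Z ≤ frobInner (S * P) (c • P) := by
  obtain ⟨B, rfl⟩ := CStarAlgebra.nonneg_iff_eq_star_mul_self.1 hS.nonneg
  rw [star_eq_conjTranspose, conjTranspose_eq_transpose_of_trivial, frobInner_polar_eq_sum, frobInner_polar_eq_sum]
  refine Finset.sum_le_sum fun i _ => ?_
  calc B i ⬝ᵥ Z *ᵥ (Pᵀ *ᵥ B i) ≤ vecNorm (B i) * vecNorm (Z *ᵥ (Pᵀ *ᵥ B i)) :=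
        dotProduct_le_vecNorm_mul _ _
    _ ≤ vecNorm (B i) * (c * vecNorm (Pᵀ *ᵥ B i)) := by
        refine mul_le_mul_of_nonneg_left ((vecNorm_mulVec_le _ _).trans ?_) (vecNorm_nonneg _)
        exact mul_le_mul_of_nonneg_right hZ (vecNorm_nonneg _)
    _ = B i ⬝ᵥ (c • P) *ᵥ (Pᵀ *ᵥ B i) := by
        rw [vecNorm_transpose_mulVec hP, smul_mulVec, mulVec_mulVec, hP, one_mulVec,
          dotProduct_smul, ← vecNorm_mul_self, smul_eq_mul]
        ring

theorem whitening_is_normalized_projection_spectral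
    {m n : ℕ} (hm : 1 ≤ m) (hmn : m ≤ n) (W : Matrix (Fin m) (Fin n) ℝ)
    (hW : (W * Wᵀ).PosDef)
    -- `S` is the unique positive definite square root of `W * Wᵀ`,
    -- so that `S⁻¹ = (W Wᵀ)^{-1/2}`.
    (S : Matrix (Fin m) (Fin m) ℝ) (hS : S.PosDef) (hSS : S * S = W * Wᵀ)
    (X : Matrix (Fin m) (Fin n) ℝ) (hX : X = Real.sqrt n • (S⁻¹ * W)) :
    specNorm X = Real.sqrt n ∧
      ∀ Z : Matrix (Fin m) (Fin n) ℝ, specNorm Z ≤ Real.sqrt n →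
        frobInner W Z ≤ frobInner W X := by
  have hdet : IsUnit S.det := (isUnit_iff_isUnit_det S).1 hS.isUnit
  have hST : Sᵀ = S := by
    rw [← conjTranspose_eq_transpose_of_trivial]
    exact hS.isHermitian
  have hP : (S⁻¹ * W) * (S⁻¹ * W)ᵀ = 1 := by
    rw [transpose_mul, transpose_nonsing_inv, hST, Matrix.mul_assoc, ← Matrix.mul_assoc W, ← hSS,
      mul_nonsing_inv_cancel_right _ _ hdet, nonsing_inv_mul _ hdet]
  subst hX
  refine ⟨specNorm_smul_of_mul_transpose_eq_one hm hP (Real.sqrt_nonneg _), fun Z hZ => ?_⟩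
  have h := frobInner_polar_le hS.posSemidef hP hZ
  rwa [mul_nonsing_inv_cancel_left _ _ hdet] at h
end

section
/- Let m, n ≥ 1 and let ∇ ∈ ℝ^{m×n} have all entries nonzero. Set A := ∇ ⊙ ∇ (entrywise square). Define vectors by v₀ := 𝟙ₙ and, for k ≥ 0, u_{k+1} := n · 𝟙ₘ / (A v_k) and v_{k+1} := m · 𝟙ₙ / (Aᵀ u_{k+1}) (divisions taken coordinatewise). Define matrices by X₀ := ∇ and, for k ≥ 0, X_{k+1} := √m · X'_k R(X'_k)^{-1} where X'_k := √n · Q(X_k)^{-1} X_k. Then for every L ≥ 1, X_L = Diag(u_L^{1/2}) ∇ Diag(v_L^{1/2}), where the square roots are taken coordinatewise; that is, the SR-Sinkhorn iterates coincide with the square-root Sinkhorn scaling of ∇. -/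
open Matrix

theorem rowNorm_eq_of_scaling {m n : ℕ} {W G : Matrix (Fin m) (Fin n) ℝ} {a : Fin m → ℝ}
    {v : Fin n → ℝ} (ha : ∀ i, 0 ≤ a i) (hv : ∀ j, 0 ≤ v j)
    (hW : ∀ i j, W i j = a i * G i j * Real.sqrt (v j)) (i : Fin m) :
    rowNorm W i = a i * Real.sqrt (∑ j, G i j * G i j * v j) := by
  have h : ∑ j, W i j ^ 2 = a i ^ 2 * ∑ j, G i j * G i j * v j := by
    rw [Finset.mul_sum]
    refine Finset.sum_congr rfl fun j _ => ?_
    rw [hW, mul_pow, mul_pow, Real.sq_sqrt (hv j)]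
    ring
  rw [rowNorm, h, Real.sqrt_mul (sq_nonneg _), Real.sqrt_sq (ha i)]

theorem inv_diagonal_of_ne_zero {m : ℕ} {d : Fin m → ℝ} (hd : ∀ i, d i ≠ 0) :
    (Matrix.diagonal d)⁻¹ = Matrix.diagonal fun i => (d i)⁻¹ := by
  refine Matrix.inv_eq_right_inv ?_
  rw [Matrix.diagonal_mul_diagonal, ← Matrix.diagonal_one]
  exact congrArg _ (funext fun i => mul_inv_cancel₀ (hd i))

/-- Normalizing the rows of a scaling of `G` replaces the row factors by one Sinkhorn update. -/
theorem row_normalize_of_scaling {m n : ℕ} {W G : Matrix (Fin m) (Fin n) ℝ} {a : Fin m → ℝ}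
    {v : Fin n → ℝ} (ha : ∀ i, 0 < a i) (hv : ∀ j, 0 ≤ v j)
    (hs : ∀ i, 0 < ∑ j, G i j * G i j * v j)
    (hW : ∀ i j, W i j = a i * G i j * Real.sqrt (v j)) {c : ℝ} (hc : 0 ≤ c)
    (i : Fin m) (j : Fin n) :
    (Real.sqrt c • ((Matrix.diagonal (rowNorm W))⁻¹ * W)) i j =
      Real.sqrt (c / ∑ j, G i j * G i j * v j) * G i j * Real.sqrt (v j) := by
  have hr := rowNorm_eq_of_scaling (fun i => (ha i).le) hv hW
  have hne : ∀ i, rowNorm W i ≠ 0 := fun i => by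
    rw [hr]
    exact (mul_pos (ha i) (Real.sqrt_pos.2 (hs i))).ne'
  have h1 := (ha i).ne'
  have h2 := (Real.sqrt_pos.2 (hs i)).ne'
  rw [inv_diagonal_of_ne_zero hne, Matrix.smul_apply, Matrix.diagonal_mul, hr, hW, smul_eq_mul,
    Real.sqrt_div hc]
  field_simp

/-- Column version of `row_normalize_of_scaling`. -/
theorem col_normalize_of_scaling {m n : ℕ} {W G : Matrix (Fin m) (Fin n) ℝ} {u : Fin m → ℝ}
    {b : Fin n → ℝ} (hb : ∀ j, 0 < b j) (hu : ∀ i, 0 ≤ u i)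
    (hs : ∀ j, 0 < ∑ i, G i j * G i j * u i)
    (hW : ∀ i j, W i j = Real.sqrt (u i) * G i j * b j) {c : ℝ} (hc : 0 ≤ c)
    (i : Fin m) (j : Fin n) :
    (Real.sqrt c • (W * (Matrix.diagonal (colNorm W))⁻¹)) i j =
      Real.sqrt (u i) * G i j * Real.sqrt (c / ∑ i, G i j * G i j * u i) := by
  have h := row_normalize_of_scaling (W := Wᵀ) (G := Gᵀ) hb hu hs
    (fun j i => by rw [Matrix.transpose_apply, Matrix.transpose_apply, hW]; ring) hc j i
  have ht : (Real.sqrt c • (W * (Matrix.diagonal (colNorm W))⁻¹))ᵀ =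
      Real.sqrt c • ((Matrix.diagonal (rowNorm Wᵀ))⁻¹ * Wᵀ) := by
    rw [Matrix.transpose_smul, Matrix.transpose_mul, Matrix.transpose_nonsing_inv,
      Matrix.diagonal_transpose]
    rfl
  rw [← ht] at h
  simp only [Matrix.transpose_apply] at h
  rw [h]
  ring


theorem srSinkhorn_eq_sqrt_sinkhorn_scaling
    {m n : ℕ} (hm : 1 ≤ m) (hn : 1 ≤ n)
    (G : Matrix (Fin m) (Fin n) ℝ) (hG : ∀ i j, G i j ≠ 0)
    -- `A = G ⊙ G` is the entrywise square of `G`.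
    (A : Matrix (Fin m) (Fin n) ℝ) (hA : ∀ i j, A i j = G i j * G i j)
    -- Sinkhorn iterates on the scaling vectors, with coordinatewise divisions.
    (u : ℕ → Fin m → ℝ) (v : ℕ → Fin n → ℝ)
    (hv0 : v 0 = fun _ => 1)
    (hu : ∀ k : ℕ, u (k + 1) = fun i => (n : ℝ) / (A.mulVec (v k)) i)
    (hv : ∀ k : ℕ, v (k + 1) = fun j => (m : ℝ) / (Aᵀ.mulVec (u (k + 1))) j)
    -- SR-Sinkhorn iterates on matrices: alternating scaled row- and column-normalization.
    (X : ℕ → Matrix (Fin m) (Fin n) ℝ) (X' : ℕ → Matrix (Fin m) (Fin n) ℝ)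
    (hX0 : X 0 = G)
    (hX' : ∀ k : ℕ, X' k = Real.sqrt n • ((Matrix.diagonal (rowNorm (X k)))⁻¹ * X k))
    (hXsucc : ∀ k : ℕ, X (k + 1) = Real.sqrt m • (X' k * (Matrix.diagonal (colNorm (X' k)))⁻¹)) :
    ∀ L : ℕ, 1 ≤ L →
      X L = Matrix.diagonal (fun i => Real.sqrt (u L i)) * G *
        Matrix.diagonal (fun j => Real.sqrt (v L j)) := by
  have : Nonempty (Fin m) := ⟨⟨0, hm⟩⟩
  have : Nonempty (Fin n) := ⟨⟨0, hn⟩⟩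
  have hm0 : (0 : ℝ) < m := by exact_mod_cast hm
  have hn0 : (0 : ℝ) < n := by exact_mod_cast hn
  have hrow : ∀ w : Fin n → ℝ, (∀ j, 0 < w j) → ∀ i, 0 < ∑ j, G i j * G i j * w j :=
    fun w hw i => Finset.sum_pos
      (fun j _ => mul_pos (mul_self_pos.2 (hG i j)) (hw j)) Finset.univ_nonempty
  have hcol : ∀ w : Fin m → ℝ, (∀ i, 0 < w i) → ∀ j, 0 < ∑ i, G i j * G i j * w i :=
    fun w hw j => Finset.sum_pos
      (fun i _ => mul_pos (mul_self_pos.2 (hG i j)) (hw i)) Finset.univ_nonempty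
  have hu' : ∀ k i, u (k + 1) i = n / ∑ j, G i j * G i j * v k j := fun k i => by
    simp only [hu, Matrix.mulVec, dotProduct, hA]
  have hv' : ∀ k j, v (k + 1) j = m / ∑ i, G i j * G i j * u (k + 1) i := fun k j => by
    simp only [hv, Matrix.mulVec, dotProduct, Matrix.transpose_apply, hA]
  have upos : ∀ k, (∀ j, 0 < v k j) → ∀ i, 0 < u (k + 1) i := fun k hk i => by
    rw [hu']
    exact div_pos hn0 (hrow _ hk i)
  have vpos : ∀ k j, 0 < v k j := by
    intro k
    induction k with
    | zero => simp [hv0]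
    | succ k ih =>
      intro j
      rw [hv']
      exact div_pos hm0 (hcol _ (upos k ih) j)
  have step : ∀ k (a : Fin m → ℝ), (∀ i, 0 < a i) →
      (∀ i j, X k i j = a i * G i j * Real.sqrt (v k j)) →
      ∀ i j, X (k + 1) i j = Real.sqrt (u (k + 1) i) * G i j * Real.sqrt (v (k + 1) j) := by
    intro k a ha hX i j
    have hX'k : ∀ i j, X' k i j = Real.sqrt (u (k + 1) i) * G i j * Real.sqrt (v k j) :=
      fun i j => by
        rw [hX', hu']
        exact row_normalize_of_scaling ha (fun j => (vpos k j).le) (hrow _ (vpos k)) hX hn0.le i j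
    rw [hXsucc, hv']
    exact col_normalize_of_scaling (fun j => Real.sqrt_pos.2 (vpos k j))
      (fun i => (upos k (vpos k) i).le) (hcol _ (upos k (vpos k))) hX'k hm0.le i j
  have main : ∀ k i j,
      X (k + 1) i j = Real.sqrt (u (k + 1) i) * G i j * Real.sqrt (v (k + 1) j) := by
    intro k
    induction k with
    | zero => exact step 0 (fun _ => 1) (fun _ => one_pos) (by simp [hX0, hv0])
    | succ k ih => exact step (k + 1) _ (fun i => Real.sqrt_pos.2 (upos k (vpos k) i)) ih
  intro L hL
  obtain ⟨k, rfl⟩ := Nat.exists_eq_add_of_le' hL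
  ext i j
  rw [main, Matrix.mul_diagonal, Matrix.diagonal_mul]
end

section
/- Let K ≥ 1, let g₁, …, g_K be norms on a finite-dimensional real inner product space E with dual norms g₁*, …, g_K*, let ε₁, …, ε_K > 0, and let ∇ ∈ E. Then strong duality holds: sup{⟨∇, z⟩ : z ∈ E, g_i(z) ≤ ε_i for all i = 1,…,K} = inf{Σ_{i=1}^K ε_i · g_i*(λ_i) : λ₁, …, λ_K ∈ E with Σ_{i=1}^K λ_i = ∇}. -/
open scoped RealInnerProductSpace

section Helpers

variable {E : Type*} [NormedAddCommGroup E] [InnerProductSpace ℝ E]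

namespace IsNorm

variable {g : E → ℝ}

theorem convexOn (hg : IsNorm g) : ConvexOn ℝ Set.univ g := by
  obtain ⟨-, -, hsmul, hadd⟩ := hg
  refine ⟨convex_univ, fun x _ y _ a b ha hb _ => (hadd _ _).trans_eq ?_⟩
  rw [hsmul, hsmul, abs_of_nonneg ha, abs_of_nonneg hb, smul_eq_mul, smul_eq_mul]

theorem map_zero (hg : IsNorm g) : g 0 = 0 := (hg.2.1 0).2 rfl

variable [FiniteDimensional ℝ E]

theorem continuous (hg : IsNorm g) : Continuous g :=
  continuousOn_univ.1 (hg.convexOn.continuousOn isOpen_univ)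

theorem exists_norm_le (hg : IsNorm g) : ∃ C : ℝ, ∀ z, ‖z‖ ≤ C * g z := by
  rcases subsingleton_or_nontrivial E with h | h
  · exact ⟨0, fun z => by simp [Subsingleton.elim z 0]⟩
  obtain ⟨x, hx, hmin⟩ := (isCompact_sphere (0 : E) 1).exists_isMinOn
    (NormedSpace.sphere_nonempty.2 zero_le_one) hg.continuous.continuousOn
  have hx0 : x ≠ 0 := ne_zero_of_mem_unit_sphere ⟨x, hx⟩
  have hpos : 0 < g x := (hg.1 x).lt_of_ne fun h => hx0 ((hg.2.1 x).1 h.symm)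
  refine ⟨(g x)⁻¹, fun z => ?_⟩
  rcases eq_or_ne z 0 with rfl | hz
  · simp [hg.map_zero]
  have hz' : 0 < ‖z‖ := norm_pos_iff.2 hz
  have hle : g x ≤ g (‖z‖⁻¹ • z) := hmin (by simp [norm_smul, hz'.ne'])
  rw [hg.2.2.1, abs_of_pos (inv_pos.2 hz'), inv_mul_eq_div, le_div_iff₀ hz'] at hle
  rwa [inv_mul_eq_div, le_div_iff₀ hpos, mul_comm]

theorem isCompact_le (hg : IsNorm g) (r : ℝ) : IsCompact {z | g z ≤ r} := by
  refine Metric.isCompact_of_isClosed_isBounded (isClosed_le hg.continuous continuous_const) ?_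
  obtain ⟨C, hC⟩ := hg.exists_norm_le
  refine isBounded_iff_forall_norm_le.2 ⟨|C| * r, fun z hz => (hC z).trans ?_⟩
  exact (mul_le_mul_of_nonneg_right (le_abs_self C) (hg.1 z)).trans
    (mul_le_mul_of_nonneg_left hz (abs_nonneg C))

theorem isGreatest_dualNorm (hg : IsNorm g) (y : E) :
    IsGreatest {r : ℝ | ∃ z : E, g z ≤ 1 ∧ r = ⟪y, z⟫} (dualNorm g y) := by
  have himage : {r : ℝ | ∃ z : E, g z ≤ 1 ∧ r = ⟪y, z⟫} = (fun z => ⟪y, z⟫) '' {z | g z ≤ 1} := by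
    ext r
    simp [eq_comm]
  have hcompact : IsCompact {r : ℝ | ∃ z : E, g z ≤ 1 ∧ r = ⟪y, z⟫} := by
    rw [himage]
    exact (hg.isCompact_le 1).image (by fun_prop)
  exact hcompact.isGreatest_sSup ⟨0, 0, by simp [hg.map_zero]⟩

theorem inner_le_mul_dualNorm (hg : IsNorm g) {r : ℝ} (hr : 0 < r) (y : E) {z : E}
    (hz : g z ≤ r) : ⟪y, z⟫ ≤ r * dualNorm g y := by
  have h := (hg.isGreatest_dualNorm y).2 ⟨r⁻¹ • z, by
    rwa [hg.2.2.1, abs_of_pos (inv_pos.2 hr), inv_mul_le_iff₀ hr, mul_one], rfl⟩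
  rwa [real_inner_smul_right, inv_mul_le_iff₀ hr] at h

end IsNorm

theorem exists_eq_sum_inner [FiniteDimensional ℝ E] {ι : Type*} [Fintype ι]
    (φ : (ι → E) →ₗ[ℝ] ℝ) : ∃ lam : ι → E, ∀ w, φ w = ∑ i, ⟪lam i, w i⟫ := by
  classical
  refine ⟨fun i => (InnerProductSpace.toDual ℝ E).symm
    (LinearMap.toContinuousLinearMap (φ ∘ₗ LinearMap.single ℝ (fun _ => E) i)), fun w => ?_⟩
  simp only [InnerProductSpace.toDual_symm_apply, LinearMap.coe_toContinuousLinearMap',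
    LinearMap.comp_apply, LinearMap.single_apply]
  rw [← map_sum, Finset.univ_sum_single]

/-- A splitting of `y` from a bound of `⟪y, ·⟫` on the intersection of the balls `g i ≤ ε i`. -/
theorem exists_sum_eq_and_sum_mul_dualNorm_le [FiniteDimensional ℝ E] {ι : Type*} [Fintype ι]
    [Nonempty ι] {g : ι → E → ℝ} (hg : ∀ i, IsNorm (g i)) {ε : ι → ℝ} (hε : ∀ i, 0 < ε i)
    {y : E} {P : ℝ} (hP : ∀ z, (∀ i, g i z ≤ ε i) → ⟪y, z⟫ ≤ P) :
    ∃ lam : ι → E, ∑ i, lam i = y ∧ ∑ i, ε i * dualNorm (g i) (lam i) ≤ P := by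
  have hP0 : 0 ≤ P := by simpa using hP 0 fun i => by simpa [(hg i).map_zero] using (hε i).le
  let v : (ι → E) → ι → ℝ := fun w i => g i (w i) / ε i
  have hv : ∀ w i, 0 ≤ v w i := fun w i => div_nonneg ((hg i).1 _) (hε i).le
  have hvle : ∀ w i, v w i ≤ ‖v w‖ := fun w i => (le_abs_self _).trans (norm_le_pi_norm (v w) i)
  let i₀ : ι := Classical.arbitrary ι
  let diag : E →ₗ[ℝ] ι → E := LinearMap.pi fun _ => LinearMap.id
  let f : (ι → E) →ₗ.[ℝ] ℝ := ⟨LinearMap.range diag,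
    ((innerₗ E y) ∘ₗ LinearMap.proj i₀) ∘ₗ (LinearMap.range diag).subtype⟩
  obtain ⟨φ, hφf, hφN⟩ := exists_extension_of_le_sublinear f (fun w => P * ‖v w‖)
    (by
      intro c hc w
      have hvc : v (c • w) = c • v w := by
        ext i
        simp [v, (hg i).2.2.1, abs_of_pos hc, mul_div_assoc]
      simp only [hvc, norm_smul, Real.norm_of_nonneg hc.le]
      ring)
    (by
      intro w w'
      rw [← mul_add]
      refine mul_le_mul_of_nonneg_left ?_ hP0
      refine (pi_norm_le_iff_of_nonneg (by positivity)).2 fun i => ?_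
      rw [Real.norm_of_nonneg (hv _ i)]
      refine le_trans ?_ (add_le_add (hvle w i) (hvle w' i))
      simp only [v, ← add_div]
      exact div_le_div_of_nonneg_right ((hg i).2.2.2 _ _) (hε i).le)
    (by
      rintro ⟨_, z, rfl⟩
      change ⟪y, z⟫ ≤ P * ‖v (diag z)‖
      rcases (norm_nonneg (v (diag z))).eq_or_lt with h0 | hpos
      · have hz : g i₀ z / ε i₀ ≤ 0 := (hvle (diag z) i₀).trans h0.ge
        have hz0 : z = 0 := ((hg i₀).2.1 z).1
          (((div_le_iff₀ (hε i₀)).1 hz).trans_eq (zero_mul _) |>.antisymm ((hg i₀).1 z))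
        simp [hz0, mul_nonneg hP0]
      · have h := hP (‖v (diag z)‖⁻¹ • z) fun i => by
          rw [(hg i).2.2.1, abs_of_pos (inv_pos.2 hpos), inv_mul_le_iff₀ hpos]
          exact (div_le_iff₀ (hε i)).1 (hvle (diag z) i)
        rwa [real_inner_smul_right, inv_mul_le_iff₀ hpos, mul_comm] at h)
  obtain ⟨lam, hlam⟩ := exists_eq_sum_inner φ
  refine ⟨lam, ext_inner_right ℝ fun z => ?_, ?_⟩
  · rw [sum_inner]
    exact (hlam (diag z)).symm.trans (hφf ⟨diag z, z, rfl⟩)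
  · choose z hz hdual using fun i => ((hg i).isGreatest_dualNorm (lam i)).1
    calc ∑ i, ε i * dualNorm (g i) (lam i) = φ fun i => ε i • z i := by
          simp only [hlam, hdual, real_inner_smul_right]
      _ ≤ P * ‖v fun i => ε i • z i‖ := hφN _
      _ ≤ P * 1 := by
          refine mul_le_mul_of_nonneg_left ?_ hP0
          refine (pi_norm_le_iff_of_nonneg zero_le_one).2 fun i => ?_
          rw [Real.norm_of_nonneg (hv (fun j => ε j • z j) i)]
          simpa [v, (hg i).2.2.1, abs_of_pos (hε i), (hε i).ne'] using hz i
      _ = P := mul_one P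

end Helpers

theorem strong_duality_multi_norm_ball
    {E : Type*} [NormedAddCommGroup E] [InnerProductSpace ℝ E] [FiniteDimensional ℝ E]
    (K : ℕ) (hK : 1 ≤ K)
    (g : Fin K → E → ℝ) (hg : ∀ i, IsNorm (g i))
    (ε : Fin K → ℝ) (hε : ∀ i, 0 < ε i) (grad : E) :
    sSup {r : ℝ | ∃ z : E, (∀ i, g i z ≤ ε i) ∧ r = ⟪grad, z⟫} =
      sInf {r : ℝ | ∃ lam : Fin K → E,
        (∑ i, lam i) = grad ∧ r = ∑ i, ε i * dualNorm (g i) (lam i)} := by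
  have : Nonempty (Fin K) := ⟨⟨0, hK⟩⟩
  have hweak : ∀ z, (∀ i, g i z ≤ ε i) → ∀ lam : Fin K → E, ∑ i, lam i = grad →
      ⟪grad, z⟫ ≤ ∑ i, ε i * dualNorm (g i) (lam i) := by
    rintro z hz lam rfl
    rw [sum_inner]
    exact Finset.sum_le_sum fun i _ => (hg i).inner_le_mul_dualNorm (hε i) (lam i) (hz i)
  have hzero : ∀ i, g i 0 ≤ ε i := fun i => by simpa [(hg i).map_zero] using (hε i).le
  have hbdd : BddAbove {r : ℝ | ∃ z : E, (∀ i, g i z ≤ ε i) ∧ r = ⟪grad, z⟫} := by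
    refine ⟨ε ⟨0, hK⟩ * dualNorm (g ⟨0, hK⟩) grad, ?_⟩
    rintro _ ⟨z, hz, rfl⟩
    exact (hg _).inner_le_mul_dualNorm (hε _) grad (hz _)
  have hprimal : ∀ z, (∀ i, g i z ≤ ε i) →
      ⟪grad, z⟫ ≤ sSup {r : ℝ | ∃ z : E, (∀ i, g i z ≤ ε i) ∧ r = ⟪grad, z⟫} :=
    fun z hz => le_csSup hbdd ⟨z, hz, rfl⟩
  obtain ⟨lam, hsum, hle⟩ := exists_sum_eq_and_sum_mul_dualNorm_le hg hε hprimal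
  apply le_antisymm
  · refine csSup_le ⟨_, 0, hzero, rfl⟩ ?_
    rintro _ ⟨z, hz, rfl⟩
    refine le_csInf ⟨_, lam, hsum, rfl⟩ ?_
    rintro _ ⟨μ, hμ, rfl⟩
    exact hweak z hz μ hμ
  · refine le_trans (csInf_le ⟨⟪grad, (0 : E)⟫, ?_⟩ ⟨lam, hsum, rfl⟩) hle
    rintro _ ⟨μ, hμ, rfl⟩
    exact hweak 0 hzero μ hμ
end
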